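/- Suppose the reversibility condition B(v,u) = (q/p)·A(u,v) holds for all (u,v) ∈ ℕ×ℕ (i.e., the system is time-reversible with respect to the involution φ(x,y) = (y^{p/q}, x^{q/p})). Then for every k ≥ 1 the k-th saddle quantity vanishes: G(k) := Σ_{0≤s₁≤k, 0≤s₂≤k, (s₁,s₂)≠(k,k)} [(s₁+1)·q·A(k−s₁, k−s₂) − (s₂+1)·p·B(k−s₁, k−s₂)]·v(s₁,s₂) = 0. Consequently the formal series Ψ(x,y) = Σ v(t₁,t₂) x^{q t₁+q} y^{p t₂+p} is a formal first integral of the system. -/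

import Mathlib

/-- The recursively defined coefficients `v(t₁,t₂)` of the formal series
`Ψ(x,y) = Σ v(t₁,t₂) x^{q t₁+q} y^{p t₂+p}` attached to the `p:-q` resonant system
`ẋ = x(p − Σ_{u+v≥1} A(u,v) x^{qu} y^{pv})`, `ẏ = −y(q − Σ_{u+v≥1} B(v,u) x^{qv} y^{pu})`:
`v(0,0) = 1`; `v(t₁,t₂) = 0` if `t₁ = t₂ ≥ 1`; and for `t₁ ≠ t₂`,
`v(t₁,t₂) = (1/(p·q·(t₁−t₂))) · Σ_{0≤s₁≤t₁, 0≤s₂≤t₂, (s₁,s₂)≠(t₁,t₂)}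
  [(s₁+1)·q·A(t₁−s₁, t₂−s₂) − (s₂+1)·p·B(t₁−s₁, t₂−s₂)]·v(s₁,s₂)`. -/
noncomputable def vc (p q : ℕ) (A B : ℕ × ℕ → ℂ) (t : ℕ × ℕ) : ℂ :=
  if t.1 = 0 ∧ t.2 = 0 then 1
  else if t.1 = t.2 then 0
  else (1 / ((p : ℂ) * (q : ℂ) * ((t.1 : ℂ) - (t.2 : ℂ)))) *
    ∑ s ∈ ((Finset.range (t.1 + 1) ×ˢ Finset.range (t.2 + 1)).erase t).attach,
      ((((s : ℕ × ℕ).1 : ℂ) + 1) * (q : ℂ)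
          * A (t.1 - (s : ℕ × ℕ).1, t.2 - (s : ℕ × ℕ).2)
        - (((s : ℕ × ℕ).2 : ℂ) + 1) * (p : ℂ)
          * B (t.1 - (s : ℕ × ℕ).1, t.2 - (s : ℕ × ℕ).2))
        * vc p q A B (s : ℕ × ℕ)
termination_by t.1 + t.2
decreasing_by
  have hmem := s.2
  rw [Finset.mem_erase, Finset.mem_product, Finset.mem_range, Finset.mem_range] at hmem
  obtain ⟨hne, h1, h2⟩ := hmem
  have : ¬((s : ℕ × ℕ).1 = t.1 ∧ (s : ℕ × ℕ).2 = t.2) := by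
    rintro ⟨e1, e2⟩
    exact hne (Prod.ext e1 e2)
  omega

/-- The `k`-th saddle quantity
`G(k) = Σ_{0≤s₁≤k, 0≤s₂≤k, (s₁,s₂)≠(k,k)}
  [(s₁+1)·q·A(k−s₁, k−s₂) − (s₂+1)·p·B(k−s₁, k−s₂)]·v(s₁,s₂)`,
the obstruction arising in the recursion for `v` at `t₁ = t₂ = k`. -/
noncomputable def G (p q : ℕ) (A B : ℕ × ℕ → ℂ) (k : ℕ) : ℂ :=
  ∑ s ∈ (Finset.range (k + 1) ×ˢ Finset.range (k + 1)).erase (k, k),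
    (((s.1 : ℂ) + 1) * (q : ℂ) * A (k - s.1, k - s.2)
      - ((s.2 : ℂ) + 1) * (p : ℂ) * B (k - s.1, k - s.2)) * vc p q A B s

/-- Sums over a punctured rectangle are reindexed by swapping the two coordinates. -/
theorem sum_erase_product_range_swap {M : Type*} [AddCommMonoid M] (t : ℕ × ℕ)
    (f : ℕ × ℕ → M) :
    ∑ s ∈ (Finset.range (t.1 + 1) ×ˢ Finset.range (t.2 + 1)).erase t, f s.swap =
      ∑ s ∈ (Finset.range (t.2 + 1) ×ˢ Finset.range (t.1 + 1)).erase t.swap, f s := by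
  refine Finset.sum_equiv (Equiv.prodComm ℕ ℕ) (fun s => ?_) (fun s _ => rfl)
  simp only [Finset.mem_erase, Finset.mem_product, Equiv.prodComm_apply, Prod.fst_swap,
    Prod.snd_swap, ne_eq, Prod.swap_inj]
  tauto

/-- Under reversibility, the recursion coefficients change sign when the two coordinates
are swapped. -/
theorem recursion_coeff_swap {p q : ℕ} (hp : 0 < p) {A B : ℕ × ℕ → ℂ}
    (hrev : ∀ u v : ℕ, B (v, u) = ((q : ℂ) / (p : ℂ)) * A (u, v)) (x y : ℂ) (m n : ℕ) :
    y * (q : ℂ) * A (n, m) - x * (p : ℂ) * B (n, m) =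
      -(x * (q : ℂ) * A (m, n) - y * (p : ℂ) * B (m, n)) := by
  have hp' : (p : ℂ) ≠ 0 := Nat.cast_ne_zero.mpr hp.ne'
  rw [hrev m n, hrev n m]
  field_simp
  ring

/-- Under reversibility, the coefficients `vc` are symmetric. -/
theorem vc_swap {p q : ℕ} (hp : 0 < p) {A B : ℕ × ℕ → ℂ}
    (hrev : ∀ u v : ℕ, B (v, u) = ((q : ℂ) / (p : ℂ)) * A (u, v)) (t : ℕ × ℕ) :
    vc p q A B t.swap = vc p q A B t := by
  induction hn : t.1 + t.2 using Nat.strong_induction_on generalizing t with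
  | _ n ih =>
  by_cases ht : t.1 = t.2
  · rw [show t.swap = t from Prod.ext ht.symm ht]
  have h0 : ¬(t.1 = 0 ∧ t.2 = 0) := fun h => ht (h.1.trans h.2.symm)
  have h0' : ¬(t.2 = 0 ∧ t.1 = 0) := fun h => h0 h.symm
  have ht' : ¬t.2 = t.1 := fun h => ht h.symm
  rw [vc, vc.eq_def p q A B t]
  simp only [Prod.fst_swap, Prod.snd_swap, if_neg ht, if_neg ht', if_neg h0, if_neg h0']
  rw [Finset.sum_attach _ (fun s : ℕ × ℕ => (((s.1 : ℂ) + 1) * (q : ℂ) * A (t.2 - s.1, t.1 - s.2)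
      - ((s.2 : ℂ) + 1) * (p : ℂ) * B (t.2 - s.1, t.1 - s.2)) * vc p q A B s),
    Finset.sum_attach _ (fun s : ℕ × ℕ => (((s.1 : ℂ) + 1) * (q : ℂ) * A (t.1 - s.1, t.2 - s.2)
      - ((s.2 : ℂ) + 1) * (p : ℂ) * B (t.1 - s.1, t.2 - s.2)) * vc p q A B s),
    ← sum_erase_product_range_swap, ← neg_sub (t.1 : ℂ), mul_neg, div_neg, neg_mul,
    ← mul_neg, ← Finset.sum_neg_distrib]
  congr 1
  refine Finset.sum_congr rfl fun s hs => ?_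
  have hlt : s.1 + s.2 < n := by
    simp only [Finset.mem_erase, Finset.mem_product, Finset.mem_range, ne_eq, Prod.ext_iff] at hs
    omega
  rw [ih _ hlt s rfl, Prod.fst_swap, Prod.snd_swap, recursion_coeff_swap hp hrev, neg_mul, neg_neg]

/-- If the reversibility condition `B(v,u) = (q/p)·A(u,v)` holds for all `(u,v) ∈ ℕ×ℕ`
(i.e. the system is time-reversible with respect to `φ(x,y) = (y^{p/q}, x^{q/p})`),
then every saddle quantity vanishes: `G(k) = 0` for all `k ≥ 1`; consequently the
formal series `Ψ(x,y) = Σ v(t₁,t₂) x^{q t₁+q} y^{p t₂+p}` is a formal first integral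
of the system. -/
theorem statement4
    (p q : ℕ) (hp : 0 < p) (hq : 0 < q) (hpq : Nat.Coprime p q)
    (A B : ℕ × ℕ → ℂ)
    (hrev : ∀ u v : ℕ, B (v, u) = ((q : ℂ) / (p : ℂ)) * A (u, v)) :
    ∀ k : ℕ, 1 ≤ k → G p q A B k = 0 := by
  intro k _
  refine self_eq_neg.mp ?_
  unfold G
  refine (sum_erase_product_range_swap (k, k) _).symm.trans ?_
  rw [← Finset.sum_neg_distrib]
  refine Finset.sum_congr rfl fun s _ => ?_
  rw [vc_swap hp hrev, Prod.fst_swap, Prod.snd_swap, recursion_coeff_swap hp hrev, neg_mul]
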